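/- Let n ≥ 1 and λ > 1. Let D_U, D_V, Γ be n×n symmetric matrices such that D_U + Γ and D_V + Γ/λ are positive definite and (D_U + Γ)⁻¹ + (D_V + Γ/λ)⁻¹ = I. Define p(u) = g(u; 0, (D_U + Γ)⁻¹) and r(v) = g(v; 0, (D_V + Γ/λ)⁻¹). Then for all measurable probability densities q_u, q_v : ℝⁿ → [0, ∞) (with respect to Lebesgue measure) satisfying the second-moment constraint ∫ u uᵀ q_u(u) du + ∫ v vᵀ q_v(v) dv = I (entrywise), and such that the integrals ∫ q_u(u) uᵀ D_U u du, ∫ q_v(v) vᵀ D_V v dv, ∫ q_u log q_u, and ∫ q_v log q_v are all finite, one has ∫ q_u(u)(−½ uᵀ D_U u − log q_u(u)) du + λ ∫ q_v(v)(−½ vᵀ D_V v − log q_v(v)) dv ≤ ∫ p(u)(−½ uᵀ D_U u − log p(u)) du + λ ∫ r(v)(−½ vᵀ D_V v − log r(v)) dv. -/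

import Mathlib

open Matrix Real MeasureTheory

lemma integrable_gaussianPDFReal_mul_pow (k : ℕ) :
    Integrable (fun x : ℝ => ProbabilityTheory.gaussianPDFReal 0 1 x * x ^ k) := by
  have h : Integrable (fun x : ℝ => x ^ k) (ProbabilityTheory.gaussianReal 0 1) := by
    have h1 := (ProbabilityTheory.memLp_id_gaussianReal (μ := 0) (v := 1) k).integrable_norm_pow'
    refine h1.mono' (by fun_prop) (Filter.Eventually.of_forall fun x => ?_)
    simp
  rw [ProbabilityTheory.gaussianReal_of_var_ne_zero 0 one_ne_zero,
    integrable_withDensity_iff_integrable_smul' (by fun_prop)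
      (Filter.Eventually.of_forall fun _ => ProbabilityTheory.gaussianPDF_lt_top)] at h
  simpa using h

lemma integral_gaussianPDFReal_mul_self :
    ∫ x : ℝ, ProbabilityTheory.gaussianPDFReal 0 1 x * x = 0 := by
  have h := ProbabilityTheory.integral_id_gaussianReal (μ := 0) (v := 1)
  rwa [ProbabilityTheory.integral_gaussianReal_eq_integral_smul one_ne_zero] at h

lemma integral_gaussianPDFReal_mul_sq :
    ∫ x : ℝ, ProbabilityTheory.gaussianPDFReal 0 1 x * (x * x) = 1 := by
  have h := ProbabilityTheory.variance_id_gaussianReal (μ := 0) (v := 1)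
  rw [ProbabilityTheory.variance_of_integral_eq_zero (by fun_prop)
    (by simp),
    ProbabilityTheory.integral_gaussianReal_eq_integral_smul one_ne_zero] at h
  simpa [pow_two] using h

/-- The density of the standard Gaussian on `ι → ℝ`, as a product of one-dimensional densities. -/
noncomputable def stdGaussianDensity {ι : Type*} [Fintype ι] (w : ι → ℝ) : ℝ :=
  ∏ i, ProbabilityTheory.gaussianPDFReal 0 1 (w i)

section

variable {ι : Type*} [Fintype ι]

lemma integrable_stdGaussianDensity : Integrable (stdGaussianDensity (ι := ι)) :=
  Integrable.fintype_prod (f := fun _ x => ProbabilityTheory.gaussianPDFReal 0 1 x)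
    fun _ => ProbabilityTheory.integrable_gaussianPDFReal 0 1

lemma integral_stdGaussianDensity : ∫ w : ι → ℝ, stdGaussianDensity w = 1 := by
  simp only [stdGaussianDensity]
  rw [integral_fintype_prod_volume_eq_prod
    (f := fun _ x => ProbabilityTheory.gaussianPDFReal 0 1 x)]
  simp [ProbabilityTheory.integral_gaussianPDFReal_eq_one]

lemma stdGaussianDensity_eq (w : ι → ℝ) :
    stdGaussianDensity w = (√(2 * π) ^ Fintype.card ι)⁻¹ * rexp (-(1 / 2) * (w ⬝ᵥ w)) := by
  simp only [stdGaussianDensity, ProbabilityTheory.gaussianPDFReal, Finset.prod_mul_distrib,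
    ← Real.exp_sum, dotProduct, Finset.mul_sum]
  congr 1
  · simp [-Real.sqrt_mul, -Real.sqrt_mul']
  · congr 1
    refine Finset.sum_congr rfl fun i _ => ?_
    simp only [NNReal.coe_one]
    ring

lemma stdGaussianDensity_mul_mul [DecidableEq ι] (i j : ι) (w : ι → ℝ) :
    stdGaussianDensity w * (w i * w j) = ∏ k, ProbabilityTheory.gaussianPDFReal 0 1 (w k) *
      ((if k = i then w k else 1) * (if k = j then w k else 1)) := by
  rw [Finset.prod_mul_distrib, Finset.prod_mul_distrib]
  simp [stdGaussianDensity]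

lemma integrable_stdGaussianDensity_mul [DecidableEq ι] (i j : ι) :
    Integrable (fun w : ι → ℝ => stdGaussianDensity w * (w i * w j)) := by
  simp_rw [stdGaussianDensity_mul_mul]
  refine Integrable.fintype_prod (f := fun k x => ProbabilityTheory.gaussianPDFReal 0 1 x *
    ((if k = i then x else 1) * (if k = j then x else 1))) fun k => ?_
  have h0 := integrable_gaussianPDFReal_mul_pow 0
  have h1 := integrable_gaussianPDFReal_mul_pow 1
  have h2 := integrable_gaussianPDFReal_mul_pow 2
  split_ifs <;> simp_all [pow_two]

lemma integral_stdGaussianDensity_mul [DecidableEq ι] (i j : ι) :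
    ∫ w : ι → ℝ, stdGaussianDensity w * (w i * w j) = (1 : Matrix ι ι ℝ) i j := by
  simp_rw [stdGaussianDensity_mul_mul]
  rw [integral_fintype_prod_volume_eq_prod
    (f := fun k x => ProbabilityTheory.gaussianPDFReal 0 1 x *
      ((if k = i then x else 1) * (if k = j then x else 1)))]
  by_cases hij : i = j
  · subst hij
    rw [Matrix.one_apply_eq]
    refine Finset.prod_eq_one fun k _ => ?_
    by_cases hk : k = i
    · simpa [hk] using integral_gaussianPDFReal_mul_sq
    · simpa [hk] using ProbabilityTheory.integral_gaussianPDFReal_eq_one 0 one_ne_zero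
  · rw [Matrix.one_apply_ne hij]
    refine Finset.prod_eq_zero (Finset.mem_univ i) ?_
    simpa [hij] using integral_gaussianPDFReal_mul_self

lemma mul_dotProduct_mulVec_eq_sum (f : (ι → ℝ) → ℝ) (M : Matrix ι ι ℝ) :
    (fun u => f u * (u ⬝ᵥ (M *ᵥ u))) =
      fun u => ∑ i, ∑ j, M i j * (f u * (u i * u j)) := by
  funext u
  simp only [dotProduct, mulVec, Finset.mul_sum]
  refine Finset.sum_congr rfl fun i _ => Finset.sum_congr rfl fun j _ => ?_
  ring

lemma integrable_mul_quadForm {f : (ι → ℝ) → ℝ}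
    (hf : ∀ i j, Integrable (fun u => f u * (u i * u j))) (M : Matrix ι ι ℝ) :
    Integrable (fun u => f u * (u ⬝ᵥ (M *ᵥ u))) := by
  rw [mul_dotProduct_mulVec_eq_sum]
  exact integrable_finsetSum _ fun i _ => integrable_finsetSum _ fun j _ =>
    (hf i j).const_mul _

lemma integral_mul_quadForm {f : (ι → ℝ) → ℝ}
    (hf : ∀ i j, Integrable (fun u => f u * (u i * u j))) (M : Matrix ι ι ℝ) :
    ∫ u, f u * (u ⬝ᵥ (M *ᵥ u)) = ∑ i, ∑ j, M i j * ∫ u, f u * (u i * u j) := by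
  rw [mul_dotProduct_mulVec_eq_sum]
  refine (integral_finsetSum _ fun i _ =>
    integrable_finsetSum _ fun j _ => (hf i j).const_mul _).trans ?_
  refine Finset.sum_congr rfl fun i _ => ?_
  refine (integral_finsetSum _ fun j _ => (hf i j).const_mul _).trans ?_
  exact Finset.sum_congr rfl fun j _ => integral_const_mul _ _

lemma integrable_comp_mulVec [DecidableEq ι] {L : Matrix ι ι ℝ} (hL : L.det ≠ 0) {F : (ι → ℝ) → ℝ}
    (hF : Integrable F) : Integrable (fun u => |L.det| * F (L *ᵥ u)) := by
  have hm : Measurable (toLin' L) := (LinearMap.continuous_on_pi _).measurable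
  have h : Integrable F (Measure.map (toLin' L) volume) := by
    rw [Real.map_matrix_volume_pi_eq_smul_volume_pi hL]
    exact hF.smul_measure ENNReal.ofReal_ne_top
  exact (h.comp_measurable hm).const_mul _

lemma integral_comp_mulVec [DecidableEq ι] {L : Matrix ι ι ℝ} (hL : L.det ≠ 0) {F : (ι → ℝ) → ℝ}
    (hF : Integrable F) : ∫ u, |L.det| * F (L *ᵥ u) = ∫ w, F w := by
  have hm : Measurable (toLin' L) := (LinearMap.continuous_on_pi _).measurable
  have hmap := Real.map_matrix_volume_pi_eq_smul_volume_pi hL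
  have h : Integrable F (Measure.map (toLin' L) volume) := by
    rw [hmap]
    exact hF.smul_measure ENNReal.ofReal_ne_top
  have h2 := integral_map hm.aemeasurable h.aestronglyMeasurable
  rw [hmap, integral_smul_measure] at h2
  simp only [toLin'_apply] at h2
  rw [integral_const_mul, ← h2, ENNReal.toReal_ofReal (abs_nonneg _), abs_inv, smul_eq_mul,
    mul_inv_cancel_left₀ (abs_ne_zero.mpr hL)]

end

/-- The centred Gaussian density with covariance matrix `A⁻¹`. -/
noncomputable def gaussianDensity {n : ℕ} (A : Matrix (Fin n) (Fin n) ℝ) (u : Fin n → ℝ) : ℝ :=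
  (√((2 * π) ^ n * (A⁻¹).det))⁻¹ * rexp (-(1 / 2) * (u ⬝ᵥ ((A⁻¹)⁻¹ *ᵥ u)))

section

variable {n : ℕ} {A : Matrix (Fin n) (Fin n) ℝ}

open scoped MatrixOrder in
lemma Matrix.PosDef.exists_eq_transpose_mul (hA : A.PosDef) :
    ∃ L : Matrix (Fin n) (Fin n) ℝ, L.det ≠ 0 ∧ A = Lᵀ * L := by
  obtain ⟨L, hL⟩ := CStarAlgebra.nonneg_iff_eq_star_mul_self.mp hA.posSemidef.nonneg
  rw [star_eq_conjTranspose, conjTranspose_eq_transpose_of_trivial] at hL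
  refine ⟨L, fun h => hA.det_pos.ne' ?_, hL⟩
  rw [hL, det_mul, h, mul_zero]

lemma gaussianDensity_eq (hA : A.PosDef) (u : Fin n → ℝ) :
    gaussianDensity A u = (√((2 * π) ^ n * (A⁻¹).det))⁻¹ * rexp (-(1 / 2) * (u ⬝ᵥ (A *ᵥ u))) := by
  rw [gaussianDensity, Matrix.nonsing_inv_nonsing_inv A (isUnit_iff_ne_zero.mpr hA.det_pos.ne')]

lemma gaussianDensity_pos (hA : A.PosDef) (u : Fin n → ℝ) : 0 < gaussianDensity A u := by
  have := hA.inv.det_pos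
  rw [gaussianDensity]
  positivity

lemma neg_log_gaussianDensity (hA : A.PosDef) (u : Fin n → ℝ) :
    -log (gaussianDensity A u) =
      log √((2 * π) ^ n * (A⁻¹).det) + 1 / 2 * (u ⬝ᵥ (A *ᵥ u)) := by
  have := hA.inv.det_pos
  rw [gaussianDensity_eq hA, Real.log_mul (by positivity) (Real.exp_ne_zero _), Real.log_exp,
    Real.log_inv]
  ring

lemma gaussianDensity_transpose_mul {L : Matrix (Fin n) (Fin n) ℝ}
    (hA : (Lᵀ * L).PosDef) (u : Fin n → ℝ) :
    gaussianDensity (Lᵀ * L) u = |L.det| * stdGaussianDensity (L *ᵥ u) := by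
  rw [gaussianDensity_eq hA, stdGaussianDensity_eq, ← mul_assoc]
  congr 1
  · rw [Matrix.det_nonsing_inv, det_mul, det_transpose, Ring.inverse_eq_inv',
      Real.sqrt_mul (by positivity), Real.sqrt_inv, Real.sqrt_mul_self_eq_abs, Fintype.card_fin,
      mul_inv, inv_inv, mul_comm]
    congr 2
    rw [Real.sqrt_eq_iff_mul_self_eq (by positivity) (by positivity), ← mul_pow,
      Real.mul_self_sqrt (by positivity)]
  · rw [← mulVec_mulVec, dotProduct_mulVec, vecMul_transpose]

lemma integrable_gaussianDensity (hA : A.PosDef) : Integrable (gaussianDensity A) := by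
  obtain ⟨L, hL, rfl⟩ := hA.exists_eq_transpose_mul
  simp_rw [funext (gaussianDensity_transpose_mul hA)]
  exact integrable_comp_mulVec hL integrable_stdGaussianDensity

lemma integral_gaussianDensity (hA : A.PosDef) : ∫ u, gaussianDensity A u = 1 := by
  obtain ⟨L, hL, rfl⟩ := hA.exists_eq_transpose_mul
  simp_rw [gaussianDensity_transpose_mul hA]
  rw [integral_comp_mulVec hL integrable_stdGaussianDensity, integral_stdGaussianDensity]

lemma dotProduct_mulVec_eq_comp {L : Matrix (Fin n) (Fin n) ℝ} (hL : L.det ≠ 0)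
    (M : Matrix (Fin n) (Fin n) ℝ) (u : Fin n → ℝ) :
    u ⬝ᵥ (M *ᵥ u) = (L *ᵥ u) ⬝ᵥ (((L⁻¹)ᵀ * M * L⁻¹) *ᵥ (L *ᵥ u)) := by
  have h : L⁻¹ *ᵥ (L *ᵥ u) = u := by
    rw [mulVec_mulVec, nonsing_inv_mul _ (isUnit_iff_ne_zero.mpr hL), one_mulVec]
  rw [← mulVec_mulVec, ← mulVec_mulVec, h,
    dotProduct_mulVec (L *ᵥ u), vecMul_transpose, h]

lemma integrable_gaussianDensity_mul_quadForm (hA : A.PosDef) (M : Matrix (Fin n) (Fin n) ℝ) :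
    Integrable (fun u => gaussianDensity A u * (u ⬝ᵥ (M *ᵥ u))) := by
  obtain ⟨L, hL, rfl⟩ := hA.exists_eq_transpose_mul
  have h := integrable_comp_mulVec hL
    (integrable_mul_quadForm integrable_stdGaussianDensity_mul ((L⁻¹)ᵀ * M * L⁻¹))
  simp_rw [← dotProduct_mulVec_eq_comp hL M, ← mul_assoc,
    ← gaussianDensity_transpose_mul hA] at h
  exact h

lemma integral_gaussianDensity_mul_quadForm (hA : A.PosDef) (M : Matrix (Fin n) (Fin n) ℝ) :
    ∫ u, gaussianDensity A u * (u ⬝ᵥ (M *ᵥ u)) = (M * A⁻¹).trace := by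
  obtain ⟨L, hL, rfl⟩ := hA.exists_eq_transpose_mul
  have h := integral_comp_mulVec hL
    (integrable_mul_quadForm integrable_stdGaussianDensity_mul ((L⁻¹)ᵀ * M * L⁻¹))
  simp_rw [← dotProduct_mulVec_eq_comp hL M, ← mul_assoc,
    ← gaussianDensity_transpose_mul hA] at h
  rw [h, integral_mul_quadForm integrable_stdGaussianDensity_mul]
  simp_rw [integral_stdGaussianDensity_mul, Matrix.one_apply, mul_ite, mul_one, mul_zero,
    Finset.sum_ite_eq, Finset.mem_univ, if_true]
  rw [Matrix.mul_inv_rev, ← Matrix.mul_assoc M, Matrix.trace_mul_comm (M * L⁻¹),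
    ← Matrix.transpose_nonsing_inv, ← Matrix.mul_assoc]
  rfl

/-- The entropy-plus-quadratic functional of the Gaussian density with covariance `(D + G)⁻¹`. -/
lemma integral_gaussianDensity_functional {D G : Matrix (Fin n) (Fin n) ℝ}
    (hA : (D + G).PosDef) :
    ∫ u, gaussianDensity (D + G) u *
        (-(1 / 2) * (u ⬝ᵥ (D *ᵥ u)) - log (gaussianDensity (D + G) u)) =
      log √((2 * π) ^ n * ((D + G)⁻¹).det) + 1 / 2 * (G * (D + G)⁻¹).trace := by
  have h (u : Fin n → ℝ) : gaussianDensity (D + G) u *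
        (-(1 / 2) * (u ⬝ᵥ (D *ᵥ u)) - log (gaussianDensity (D + G) u)) =
      log √((2 * π) ^ n * ((D + G)⁻¹).det) * gaussianDensity (D + G) u +
        1 / 2 * (gaussianDensity (D + G) u * (u ⬝ᵥ (G *ᵥ u))) := by
    rw [sub_eq_add_neg, neg_log_gaussianDensity hA, add_mulVec, dotProduct_add]
    ring
  simp_rw [h]
  rw [integral_add ((integrable_gaussianDensity hA).const_mul _)
      ((integrable_gaussianDensity_mul_quadForm hA G).const_mul _),
    integral_const_mul, integral_const_mul, integral_gaussianDensity hA,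
    integral_gaussianDensity_mul_quadForm hA, mul_one]

/-- Pointwise form of Gibbs' inequality. -/
lemma neg_mul_log_le {q p : ℝ} (hq : 0 ≤ q) (hp : 0 < p) :
    -(q * log q) ≤ q * -log p + (p - q) := by
  rcases hq.eq_or_lt with rfl | hq
  · simpa using hp.le
  · have h := mul_le_mul_of_nonneg_left (Real.log_le_sub_one_of_pos (div_pos hp hq)) hq.le
    rw [Real.log_div hp.ne' hq.ne', mul_sub, mul_sub, mul_div_cancel₀ _ hq.ne'] at h
    linarith

/-- Gibbs' inequality against the Gaussian density with covariance `(D + G)⁻¹`. -/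
lemma integral_functional_le {D G : Matrix (Fin n) (Fin n) ℝ} (hA : (D + G).PosDef)
    {q : (Fin n → ℝ) → ℝ} (hq : ∀ u, 0 ≤ q u) (hprob : ∫ u, q u = 1)
    (hmom : ∀ i j, Integrable (fun u => q u * (u i * u j)))
    (hent : Integrable (fun u => q u * log (q u))) :
    ∫ u, q u * (-(1 / 2) * (u ⬝ᵥ (D *ᵥ u)) - log (q u)) ≤
      log √((2 * π) ^ n * ((D + G)⁻¹).det) +
        1 / 2 * ∑ i, ∑ j, G i j * ∫ u, q u * (u i * u j) := by
  have hqi : Integrable q := by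
    by_contra h
    rw [integral_undef h] at hprob
    exact zero_ne_one hprob
  have hD := integrable_mul_quadForm hmom D
  have hG := integrable_mul_quadForm hmom G
  have hp := integrable_gaussianDensity hA
  set K := log √((2 * π) ^ n * ((D + G)⁻¹).det)
  have hleft : Integrable (fun u => q u * (-(1 / 2) * (u ⬝ᵥ (D *ᵥ u)) - log (q u))) := by
    refine ((hD.const_mul (-(1 / 2))).sub hent).congr (Filter.Eventually.of_forall fun u => ?_)
    simp only [Pi.sub_apply]
    ring
  have hKG : Integrable (fun u => K * q u + 1 / 2 * (q u * (u ⬝ᵥ (G *ᵥ u)))) :=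
    (hqi.const_mul K).add (hG.const_mul (1 / 2))
  have hdiff : Integrable (fun u => gaussianDensity (D + G) u - q u) := hp.sub hqi
  calc _ ≤ ∫ u, (K * q u + 1 / 2 * (q u * (u ⬝ᵥ (G *ᵥ u)))) +
        (gaussianDensity (D + G) u - q u) := by
        refine integral_mono hleft (hKG.add hdiff) fun u => ?_
        have h := neg_mul_log_le (hq u) (gaussianDensity_pos hA u)
        rw [neg_log_gaussianDensity hA, add_mulVec, dotProduct_add] at h
        simp only
        linarith
    _ = _ := by
        rw [integral_add hKG hdiff, integral_add (hqi.const_mul K) (hG.const_mul (1 / 2)),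
          integral_sub hp hqi, integral_const_mul, integral_const_mul, hprob,
          integral_gaussianDensity hA, integral_mul_quadForm hmom]
        ring

end

/-- Theorem 3 of the paper: under the covariance-sum constraint
`∫ u uᵀ q_u + ∫ v vᵀ q_v = I`, the entropy-plus-quadratic functional is maximized by the
Gaussian densities `p = g(·; 0, (D_U + Γ)⁻¹)` and `r = g(·; 0, (D_V + Γ/λ)⁻¹)`. -/
theorem stmt6 (n : ℕ) (hn : 1 ≤ n) (lam : ℝ) (hlam : 1 < lam)
    (DU DV Γ : Matrix (Fin n) (Fin n) ℝ)
    (hDU : DU.IsSymm) (hDV : DV.IsSymm) (hΓ : Γ.IsSymm)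
    (hPU : (DU + Γ).PosDef) (hPV : (DV + lam⁻¹ • Γ).PosDef)
    (hsum : (DU + Γ)⁻¹ + (DV + lam⁻¹ • Γ)⁻¹ = 1)
    (p g : (Fin n → ℝ) → ℝ)
    (hp : p = fun u => (Real.sqrt ((2 * Real.pi) ^ n * ((DU + Γ)⁻¹).det))⁻¹ *
        Real.exp (-(1 / 2) * (u ⬝ᵥ (((DU + Γ)⁻¹)⁻¹ *ᵥ u))))
    (hg : g = fun v => (Real.sqrt ((2 * Real.pi) ^ n * ((DV + lam⁻¹ • Γ)⁻¹).det))⁻¹ *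
        Real.exp (-(1 / 2) * (v ⬝ᵥ (((DV + lam⁻¹ • Γ)⁻¹)⁻¹ *ᵥ v))))
    (qu qv : (Fin n → ℝ) → ℝ)
    (hqu_meas : Measurable qu) (hqv_meas : Measurable qv)
    (hqu_nonneg : ∀ u, 0 ≤ qu u) (hqv_nonneg : ∀ v, 0 ≤ qv v)
    (hqu_prob : (∫ u : Fin n → ℝ, qu u) = 1) (hqv_prob : (∫ v : Fin n → ℝ, qv v) = 1)
    (hqu_mom : ∀ i j : Fin n, Integrable (fun u : Fin n → ℝ => qu u * (u i * u j)))
    (hqv_mom : ∀ i j : Fin n, Integrable (fun v : Fin n → ℝ => qv v * (v i * v j)))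
    (hconstraint : ∀ i j : Fin n,
      (∫ u : Fin n → ℝ, qu u * (u i * u j)) + (∫ v : Fin n → ℝ, qv v * (v i * v j)) =
        (1 : Matrix (Fin n) (Fin n) ℝ) i j)
    (hqu_quad : Integrable (fun u : Fin n → ℝ => qu u * (u ⬝ᵥ (DU *ᵥ u))))
    (hqv_quad : Integrable (fun v : Fin n → ℝ => qv v * (v ⬝ᵥ (DV *ᵥ v))))
    (hqu_ent : Integrable (fun u : Fin n → ℝ => qu u * Real.log (qu u)))
    (hqv_ent : Integrable (fun v : Fin n → ℝ => qv v * Real.log (qv v))) :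
    (∫ u : Fin n → ℝ, qu u * (-(1 / 2) * (u ⬝ᵥ (DU *ᵥ u)) - Real.log (qu u)))
      + lam * (∫ v : Fin n → ℝ, qv v * (-(1 / 2) * (v ⬝ᵥ (DV *ᵥ v)) - Real.log (qv v)))
    ≤ (∫ u : Fin n → ℝ, p u * (-(1 / 2) * (u ⬝ᵥ (DU *ᵥ u)) - Real.log (p u)))
      + lam * (∫ v : Fin n → ℝ, g v * (-(1 / 2) * (v ⬝ᵥ (DV *ᵥ v)) - Real.log (g v))) := by
  have hp' : p = gaussianDensity (DU + Γ) := hp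
  have hg' : g = gaussianDensity (DV + lam⁻¹ • Γ) := hg
  have hU := integral_functional_le hPU hqu_nonneg hqu_prob hqu_mom hqu_ent
  have hV := mul_le_mul_of_nonneg_left
    (integral_functional_le hPV hqv_nonneg hqv_prob hqv_mom hqv_ent) (by linarith : 0 ≤ lam)
  have hlam0 : lam ≠ 0 := by linarith
  rw [hp', hg', integral_gaussianDensity_functional hPU, integral_gaussianDensity_functional hPV]
  have hmom : (∑ i, ∑ j, Γ i j * ∫ u : Fin n → ℝ, qu u * (u i * u j)) +
      lam * (∑ i, ∑ j, (lam⁻¹ • Γ) i j * ∫ v : Fin n → ℝ, qv v * (v i * v j)) = Γ.trace := by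
    calc _ = ∑ i, ∑ j, Γ i j * (1 : Matrix (Fin n) (Fin n) ℝ) i j := by
          simp only [Finset.mul_sum, ← Finset.sum_add_distrib]
          refine Finset.sum_congr rfl fun i _ => Finset.sum_congr rfl fun j _ => ?_
          rw [Matrix.smul_apply, smul_eq_mul, ← hconstraint i j, mul_assoc lam⁻¹,
            mul_inv_cancel_left₀ hlam0, mul_add]
      _ = Γ.trace := by simp [Matrix.one_apply, Matrix.trace]
  have htr : (Γ * (DU + Γ)⁻¹).trace + lam * (lam⁻¹ • Γ * (DV + lam⁻¹ • Γ)⁻¹).trace =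
      Γ.trace := by
    rw [Matrix.smul_mul, Matrix.trace_smul, smul_eq_mul, mul_inv_cancel_left₀ hlam0,
      ← Matrix.trace_add, ← Matrix.mul_add, hsum, Matrix.mul_one]
  linarith
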